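/- The group G embeds into the finitely presented group 𝔾̃: there exists an injective group homomorphism G → 𝔾̃ sending the tree automorphisms a, b, c to the images in 𝔾̃ of the generators a, b, c. -/

import Mathlib

/-- The tree automorphism `a` as a function: flips the first letter. -/
def aFun : List Bool → List Bool
  | [] => []
  | x :: w => (!x) :: w

mutual
  /-- The tree automorphism `b` as a function. -/
  def bFun : List Bool → List Bool
    | [] => []
    | false :: w => false :: aFun w
    | true :: w => true :: cFun w
  /-- The tree automorphism `c` as a function. -/
  def cFun : List Bool → List Bool
    | [] => []
    | false :: w => false :: bFun w
    | true :: w => true :: w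
end

theorem aFun_involutive : Function.Involutive aFun := by
  intro w
  cases w with
  | nil => rfl
  | cons x t => cases x <;> rfl

theorem bcFun_involutive : ∀ w, bFun (bFun w) = w ∧ cFun (cFun w) = w := by
  intro w
  induction w with
  | nil => exact ⟨rfl, rfl⟩
  | cons x t ih =>
    cases x
    · exact ⟨by simp [bFun, aFun_involutive t], by simp [cFun, ih.1]⟩
    · exact ⟨by simp [bFun, ih.2], by simp [cFun]⟩

/-- The tree automorphism `a` of the binary rooted tree `{0,1}*`. -/
def treeA : Equiv.Perm (List Bool) := Function.Involutive.toPerm aFun aFun_involutive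

/-- The tree automorphism `b` of the binary rooted tree `{0,1}*`. -/
def treeB : Equiv.Perm (List Bool) :=
  Function.Involutive.toPerm bFun (fun w => (bcFun_involutive w).1)

/-- The tree automorphism `c` of the binary rooted tree `{0,1}*`. -/
def treeC : Equiv.Perm (List Bool) :=
  Function.Involutive.toPerm cFun (fun w => (bcFun_involutive w).2)

/-- The group `G = IMG(z²+i)`, the subgroup of `Perm({0,1}*)` generated by `a`, `b`, `c`. -/
def IMG : Subgroup (Equiv.Perm (List Bool)) := Subgroup.closure {treeA, treeB, treeC}

theorem treeA_mem_IMG : treeA ∈ IMG := Subgroup.subset_closure (by simp)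
theorem treeB_mem_IMG : treeB ∈ IMG := Subgroup.subset_closure (by simp)
theorem treeC_mem_IMG : treeC ∈ IMG := Subgroup.subset_closure (by simp)

/-- `a` as an element of the group `G`. -/
def gA : IMG := ⟨treeA, treeA_mem_IMG⟩
/-- `b` as an element of the group `G`. -/
def gB : IMG := ⟨treeB, treeB_mem_IMG⟩
/-- `c` as an element of the group `G`. -/
def gC : IMG := ⟨treeC, treeC_mem_IMG⟩

/-- The commutator `[x, y] = x⁻¹y⁻¹xy`. -/
def commElt {M : Type*} [Group M] (x y : M) : M := x⁻¹ * y⁻¹ * x * y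

/-- The ten relators of the finitely presented group `𝔾̃` on the generators
`a = 0`, `b = 1`, `c = 2`, `s = 3`. -/
def GtildeRels : Set (FreeGroup (Fin 4)) :=
  let fa := FreeGroup.of (0 : Fin 4)
  let fb := FreeGroup.of (1 : Fin 4)
  let fc := FreeGroup.of (2 : Fin 4)
  let fs := FreeGroup.of (3 : Fin 4)
  {fa ^ 2,
    (fa * fc) ^ 4,
    commElt fc (fa * fb) ^ 2,
    commElt fc (fb * fa * fb) ^ 2,
    commElt fc (fa * fb * fa * fb * fa) ^ 2,
    commElt fc (fa * fb * fa * fb * fa * fb) ^ 2,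
    commElt fc (fb * fa * fb * fa * fb * fa * fb) ^ 2,
    fs⁻¹ * fa * fs * fb⁻¹,
    fs⁻¹ * fb * fs * fc⁻¹,
    fs⁻¹ * fc * fs * (fa * fb * fa)⁻¹}

/-- The finitely presented group `𝔾̃` with 4 generators and 10 relators. -/
abbrev Gtilde : Type := PresentedGroup GtildeRels

namespace IMGEmbedding

open Equiv

/-- The free group on `a = 0`, `b = 1`, `c = 2`. -/
abbrev F : Type := FreeGroup (Fin 3)

abbrev fa : F := FreeGroup.of 0
abbrev fb : F := FreeGroup.of 1
abbrev fc : F := FreeGroup.of 2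

/-- The substitution `a ↦ b`, `b ↦ c`, `c ↦ aba`. -/
def subst : F →* F := FreeGroup.lift ![fb, fc, fa * fb * fa]

/-- The substitution `a ↦ c`, `b ↦ 1`, `c ↦ a`, recording the section of `subst w` at the
letter `1`. -/
def cosubst : F →* F := FreeGroup.lift ![fc, 1, fa]

@[simp] theorem subst_a : subst fa = fb := by simp [subst]
@[simp] theorem subst_b : subst fb = fc := by simp [subst]
@[simp] theorem subst_c : subst fc = fa * fb * fa := by simp [subst]
@[simp] theorem cosubst_a : cosubst fa = fc := by simp [cosubst]
@[simp] theorem cosubst_b : cosubst fb = 1 := by simp [cosubst]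
@[simp] theorem cosubst_c : cosubst fc = fa := by simp [cosubst]

/-- The relators of the endomorphic presentation, before iterating the substitution. -/
def baseRels : Set F :=
  {fa ^ 2,
    (fa * fc) ^ 4,
    commElt fc (fa * fb) ^ 2,
    commElt fc (fb * fa * fb) ^ 2,
    commElt fc (fa * fb * fa * fb * fa) ^ 2,
    commElt fc (fa * fb * fa * fb * fa * fb) ^ 2,
    commElt fc (fb * fa * fb * fa * fb * fa * fb) ^ 2}

/-- All iterates of the base relators under the substitution. -/
def iterRels : Set F := {w | ∃ (n : ℕ), ∃ r ∈ baseRels, w = subst^[n] r}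

theorem subst_mem_iterRels {w : F} (hw : w ∈ iterRels) : subst w ∈ iterRels := by
  obtain ⟨n, r, hr, rfl⟩ := hw
  exact ⟨n + 1, r, hr, (Function.iterate_succ_apply' _ _ _).symm⟩

theorem baseRels_subset_iterRels : baseRels ⊆ iterRels := fun r hr => ⟨0, r, hr, rfl⟩

section Kills

variable {M : Type*} [Group M]

/-- The homomorphism `f` kills every base relator. -/
def Kills (f : F →* M) : Prop := ∀ r ∈ baseRels, f r = 1

theorem kills_iff (f : F →* M) : Kills f ↔
    f fa ^ 2 = 1 ∧ (f fa * f fc) ^ 4 = 1 ∧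
    commElt (f fc) (f fa * f fb) ^ 2 = 1 ∧
    commElt (f fc) (f fb * f fa * f fb) ^ 2 = 1 ∧
    commElt (f fc) (f fa * f fb * f fa * f fb * f fa) ^ 2 = 1 ∧
    commElt (f fc) (f fa * f fb * f fa * f fb * f fa * f fb) ^ 2 = 1 ∧
    commElt (f fc) (f fb * f fa * f fb * f fa * f fb * f fa * f fb) ^ 2 = 1 := by
  simp [Kills, baseRels, commElt]

theorem inv_eq_self_of_sq {x : M} (h : x * x = 1) : x⁻¹ = x := inv_eq_of_mul_eq_one_left h

theorem mul_cancel_of_sq {x : M} (h : x * x = 1) (y : M) : x * (x * y) = y := by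
  rw [← mul_assoc, h, one_mul]

theorem mul_comm_pow_eq_one {x y : M} {n : ℕ} (hx : x * x = 1) (hy : y * y = 1)
    (h : (x * y) ^ n = 1) : (y * x) ^ n = 1 := by
  have : y * x = (x * y)⁻¹ := by
    rw [mul_inv_rev, inv_eq_self_of_sq hx, inv_eq_self_of_sq hy]
  rw [this, inv_pow, h, inv_one]

theorem kills_of_map_b_eq_one {f : F →* M} (ha : f fa * f fa = 1) (hc : f fc * f fc = 1)
    (hac : (f fa * f fc) ^ 4 = 1) (hb : f fb = 1) : Kills f := by
  rw [kills_iff]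
  have hca := mul_comm_pow_eq_one ha hc hac
  simp only [pow_succ, pow_zero, one_mul, mul_assoc] at hca
  refine ⟨?_, hac, ?_, ?_, ?_, ?_, ?_⟩ <;>
  simp [commElt, pow_succ, hb, inv_eq_self_of_sq ha, inv_eq_self_of_sq hc, mul_assoc, ha,
    hca]

theorem kills_iterate_of_mem_pair {x : M} (hx : x * x = 1) (n : ℕ) {f : F →* M}
    (ha : f fa = 1 ∨ f fa = x) (hb : f fb = 1 ∨ f fb = x) (hc : f fc = 1 ∨ f fc = x)
    {r : F} (hr : r ∈ baseRels) : f (subst^[n] r) = 1 := by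
  induction n generalizing f with
  | zero =>
    suffices Kills f from this r hr
    rw [kills_iff]
    rcases ha with ha | ha <;> rcases hb with hb | hb <;> rcases hc with hc | hc <;>
    simp [commElt, ha, hb, hc, pow_succ, hx]
  | succ n ih =>
    rw [Function.iterate_succ_apply']
    refine ih (f := f.comp subst) (by simpa using hb) (by simpa using hc) ?_
    rcases ha with ha | ha <;> rcases hb with hb | hb <;> simp [ha, hb, hx]

/-- Dihedral relations on `a, c` suffice for the section at `1` to kill all relators. -/
theorem map_cosubst_iterRels {p : F →* M} (ha : p fa * p fa = 1) (hc : p fc * p fc = 1)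
    (hac : (p fa * p fc) ^ 4 = 1) {w : F} (hw : w ∈ iterRels) : p (cosubst w) = 1 := by
  obtain ⟨n, r, hr, rfl⟩ := hw
  have hca := mul_comm_pow_eq_one ha hc hac
  rcases n with _ | n
  · exact kills_of_map_b_eq_one (f := p.comp cosubst) (by simpa) (by simpa) (by simpa)
      (by simp) r hr
  · rw [Function.iterate_succ_apply']
    exact kills_iterate_of_mem_pair ha n (f := (p.comp cosubst).comp subst)
      (by simp) (by simp) (by simp [hc]) hr

end Kills

section Wreath

variable {X : Type*}

/-- The permutation of `Bool × X` flipping the first coordinate. -/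
def swapFirst : Perm (Bool × X) := Equiv.prodCongr Equiv.boolNot (Equiv.refl X)

/-- The permutation of `Bool × X` acting by `g` over `false` and by `h` over `true`. -/
def fiberwise (g h : Perm X) : Perm (Bool × X) :=
  Equiv.prodShear (Equiv.refl Bool) fun x => cond x h g

/-- The wreath recursion `a = (1, 1)σ`, `b = (a, c)`, `c = (b, 1)`, as an action on
`Bool × X`. -/
def wreath (p : F →* Perm X) : F →* Perm (Bool × X) :=
  FreeGroup.lift ![swapFirst, fiberwise (p fa) (p fc), fiberwise (p fb) 1]

variable (p : F →* Perm X)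

@[simp] theorem wreath_a (x : Bool) (h : X) : wreath p fa (x, h) = (!x, h) := by
  simp [wreath, swapFirst]
@[simp] theorem wreath_b_false (h : X) : wreath p fb (false, h) = (false, p fa h) := by
  simp [wreath, fiberwise]
@[simp] theorem wreath_b_true (h : X) : wreath p fb (true, h) = (true, p fc h) := by
  simp [wreath, fiberwise]
@[simp] theorem wreath_c_false (h : X) : wreath p fc (false, h) = (false, p fb h) := by
  simp [wreath, fiberwise]
@[simp] theorem wreath_c_true (h : X) : wreath p fc (true, h) = (true, h) := by
  simp [wreath, fiberwise]

theorem wreath_subst (w : F) (h : X) :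
    wreath p (subst w) (false, h) = (false, p w h) ∧
      wreath p (subst w) (true, h) = (true, p (cosubst w) h) := by
  induction w using FreeGroup.induction_on generalizing h with
  | C1 => simp
  | of i => fin_cases i <;> simp
  | inv_of i ih =>
    simp only [map_inv, Perm.inv_eq_iff_eq]
    exact ⟨by rw [(ih _).1]; simp, by rw [(ih _).2]; simp⟩
  | mul u v hu hv => simp [hu, hv]

variable {p}

theorem wreath_kills (ha : p fa * p fa = 1) (hb : p fb * p fb = 1) (hc : p fc * p fc = 1) :
    Kills (wreath p) := by
  have ha' (h : X) : p fa (p fa h) = h := by rw [← Perm.mul_apply, ha]; rfl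
  have hb' (h : X) : p fb (p fb h) = h := by rw [← Perm.mul_apply, hb]; rfl
  have hc' (h : X) : p fc (p fc h) = h := by rw [← Perm.mul_apply, hc]; rfl
  have hwa : (wreath p fa)⁻¹ = wreath p fa := by
    refine inv_eq_self_of_sq (Equiv.ext fun ⟨x, h⟩ => ?_)
    simp
  have hwb : (wreath p fb)⁻¹ = wreath p fb := by
    refine inv_eq_self_of_sq (Equiv.ext fun ⟨x, h⟩ => ?_)
    cases x <;> simp [ha', hc']
  have hwc : (wreath p fc)⁻¹ = wreath p fc := by
    refine inv_eq_self_of_sq (Equiv.ext fun ⟨x, h⟩ => ?_)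
    cases x <;> simp [hb']
  rw [kills_iff]
  refine ⟨?_, ?_, ?_, ?_, ?_, ?_, ?_⟩ <;> ext1 ⟨x, h⟩ <;> cases x <;>
  simp [commElt, pow_succ, hwa, hwb, hwc, ha', hb', hc']

theorem wreath_subst_eq_one {w : F} (h0 : p w = 1) (h1 : p (cosubst w) = 1) :
    wreath p (subst w) = 1 := by
  ext1 ⟨x, h⟩
  cases x
  · simp [(wreath_subst p w h).1, h0]
  · simp [(wreath_subst p w h).2, h1]

/-- The element of the free group spelled by a list of letters. -/
def word (l : List (Fin 3)) : F := (l.map FreeGroup.of).prod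

@[simp] theorem word_nil : word [] = 1 := rfl
@[simp] theorem word_cons (g : Fin 3) (l : List (Fin 3)) :
    word (g :: l) = FreeGroup.of g * word l := by simp [word]

/-- The image of the first-level vertex `x` under a word. -/
def image (x : Bool) : List (Fin 3) → Bool
  | [] => x
  | g :: l => if g = 0 then !image x l else image x l

/-- The section of a generator at a first-level vertex. -/
def letterSection : Fin 3 → Bool → List (Fin 3)
  | 0, _ => []
  | 1, false => [0]
  | 1, true => [2]
  | 2, false => [1]
  | 2, true => []

/-- The section of a word at a first-level vertex. -/
def wordSection (x : Bool) : List (Fin 3) → List (Fin 3)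
  | [] => []
  | g :: l => letterSection g (image x l) ++ wordSection x l

theorem wreath_word (p : F →* Perm X) (l : List (Fin 3)) (x : Bool) (h : X) :
    wreath p (word l) (x, h) = (image x l, p (word (wordSection x l)) h) := by
  induction l with
  | nil => simp [image, wordSection]
  | cons g l ih =>
    rw [word_cons, map_mul, Perm.mul_apply, ih]
    simp only [image, wordSection]
    generalize image x l = y
    fin_cases g <;> cases y <;> simp [letterSection]

theorem length_wordSection (x : Bool) (l : List (Fin 3)) :
    (wordSection x l).length + l.count 0 ≤ l.length := by
  induction l with
  | nil => simp [wordSection]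
  | cons g l ih =>
    simp only [wordSection]
    generalize image x l = y
    fin_cases g <;> cases y <;> simp [letterSection] <;> omega

theorem wordSection_of_zero_notMem {l : List (Fin 3)} (hl : 0 ∉ l) :
    (∀ g ∈ wordSection true l, g = 2) ∧ (∀ g ∈ wordSection false l, g = 0 ∨ g = 1) := by
  have him : ∀ x, image x l = x := by
    intro x
    induction l with
    | nil => rfl
    | cons g l ih =>
      simp only [List.mem_cons, not_or] at hl
      simp [image, Ne.symm hl.1, ih hl.2]
  induction l with
  | nil => simp [wordSection]
  | cons g l ih =>
    simp only [List.mem_cons, not_or] at hl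
    have him' : ∀ x, image x l = x := by
      intro x
      simpa [image, Ne.symm hl.1] using him x
    have ih := ih hl.2 him'
    simp only [wordSection, him', List.mem_append]
    refine ⟨?_, ?_⟩ <;> rintro h (hh | hh)
    · revert hl hh; fin_cases g <;> simp [letterSection]
    · exact ih.1 h hh
    · revert hl hh; fin_cases g <;> simp +contextual [letterSection]
    · exact ih.2 h hh

end Wreath

/-- The group given by the endomorphic presentation. -/
abbrev Gam : Type := PresentedGroup iterRels

/-- The projection of the free group. -/
def proj : F →* Gam := PresentedGroup.mk iterRels

theorem proj_iterRels {w : F} (hw : w ∈ iterRels) : proj w = 1 :=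
  PresentedGroup.one_of_mem hw

theorem proj_a_sq : proj fa * proj fa = 1 := by
  rw [← map_mul, ← pow_two]
  exact proj_iterRels ⟨0, fa ^ 2, by simp [baseRels], by simp⟩
theorem proj_b_sq : proj fb * proj fb = 1 := by
  rw [← map_mul, ← pow_two]
  exact proj_iterRels ⟨1, fa ^ 2, by simp [baseRels], by simp⟩
theorem proj_c_sq : proj fc * proj fc = 1 := by
  rw [← map_mul, ← pow_two]
  exact proj_iterRels ⟨2, fa ^ 2, by simp [baseRels], by simp⟩

theorem proj_kills : Kills proj := fun _ hr => proj_iterRels (baseRels_subset_iterRels hr)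

section Descend

variable {M : Type*} [Group M]

/-- Descend a homomorphism of the free group which kills the relators. -/
def descend (f : F →* M) (hf : ∀ w ∈ iterRels, f w = 1) : Gam →* M :=
  QuotientGroup.lift _ f fun _ hw => Subgroup.normalClosure_le_normal (N := f.ker) hf hw

theorem descend_proj (f : F →* M) (hf : ∀ w ∈ iterRels, f w = 1) (w : F) :
    descend f hf (proj w) = f w := rfl

end Descend

theorem proj_surjective : Function.Surjective proj := PresentedGroup.mk_surjective _

/-- The endomorphism induced by the substitution. -/
def phi : Gam →* Gam :=
  descend (proj.comp subst) fun _ hw => proj_iterRels (subst_mem_iterRels hw)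

/-- The endomorphism induced by `a ↦ c`, `b ↦ 1`, `c ↦ a`. -/
def psi : Gam →* Gam :=
  descend (proj.comp cosubst) fun _ hw =>
    map_cosubst_iterRels proj_a_sq proj_c_sq ((kills_iff _).1 proj_kills).2.1 hw

theorem phi_proj (w : F) : phi (proj w) = proj (subst w) := descend_proj _ _ w
theorem psi_proj (w : F) : psi (proj w) = proj (cosubst w) := descend_proj _ _ w

/-- The left regular representation, pulled back to the free group. -/
def regular : F →* Perm Gam := (MulAction.toPermHom Gam Gam).comp proj

theorem regular_apply (w : F) (h : Gam) : regular w h = proj w * h := rfl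

theorem regular_eq_one {w : F} (hw : proj w = 1) : regular w = 1 := by
  rw [regular, MonoidHom.comp_apply, hw, map_one]

theorem regular_sq {w : F} (hw : proj w * proj w = 1) : regular w * regular w = 1 := by
  rw [← map_mul]
  exact regular_eq_one (by simpa using hw)

/-- The wreath recursion on the presented group. -/
def act : Gam →* Perm (Bool × Gam) :=
  descend (wreath regular) (by
    rintro _ ⟨n, r, hr, rfl⟩
    cases n with
    | zero =>
      exact wreath_kills (regular_sq proj_a_sq) (regular_sq proj_b_sq) (regular_sq proj_c_sq) r hr
    | succ n =>
      rw [Function.iterate_succ_apply']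
      have hw : subst^[n] r ∈ iterRels := ⟨n, r, hr, rfl⟩
      refine wreath_subst_eq_one (regular_eq_one (proj_iterRels hw)) (regular_eq_one ?_)
      rw [← psi_proj, proj_iterRels hw, map_one])

theorem act_proj (w : F) : act (proj w) = wreath regular w := descend_proj _ _ w

theorem act_phi_false (g h : Gam) : act (phi g) (false, h) = (false, g * h) := by
  obtain ⟨w, rfl⟩ := proj_surjective g
  rw [phi_proj, act_proj, (wreath_subst _ _ _).1, regular_apply]

theorem act_phi_true (g h : Gam) : act (phi g) (true, h) = (true, psi g * h) := by
  obtain ⟨w, rfl⟩ := proj_surjective g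
  rw [phi_proj, act_proj, (wreath_subst _ _ _).2, regular_apply, psi_proj]

theorem phi_injective : Function.Injective phi := by
  rw [injective_iff_map_eq_one]
  intro g hg
  simpa [hg] using (act_phi_false g 1).symm

abbrev ga : Gam := proj fa
abbrev gb : Gam := proj fb
abbrev gc : Gam := proj fc

theorem phi_a : phi ga = gb := by simp [phi_proj]
theorem phi_b : phi gb = gc := by simp [phi_proj]
theorem phi_c : phi gc = ga * gb * ga := by simp [phi_proj]
theorem psi_b : psi gb = 1 := by simp [psi_proj]

theorem commute_of_commElt_sq {M : Type*} [Group M] {c t : M} (hc : c * c = 1)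
    (h : commElt c t ^ 2 = 1) : Commute c (t⁻¹ * c * t) := by
  have h' : (c * (t⁻¹ * c * t)) * (c * (t⁻¹ * c * t)) = 1 := by
    simpa [commElt, pow_two, inv_eq_self_of_sq hc, mul_assoc] using h
  have hd : (t⁻¹ * c * t) * (t⁻¹ * c * t) = 1 := by
    simp [mul_assoc, mul_cancel_of_sq hc]
  have := inv_eq_of_mul_eq_one_left h'
  rw [mul_inv_rev, inv_eq_self_of_sq hc, inv_eq_self_of_sq hd] at this
  exact this.symm

theorem induction_left {P : Gam → Prop} (one : P 1) (ha : ∀ g, P g → P (ga * g))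
    (hb : ∀ g, P g → P (gb * g)) (hc : ∀ g, P g → P (gc * g)) (g : Gam) : P g := by
  obtain ⟨w, rfl⟩ := proj_surjective g
  suffices ∀ h, P h → P (proj w * h) by simpa using this 1 one
  induction w using FreeGroup.induction_on with
  | C1 => simp
  | of i => fin_cases i <;> assumption
  | inv_of i ih =>
    rw [map_inv]
    fin_cases i
    · exact (inv_eq_self_of_sq proj_a_sq).symm ▸ ha
    · exact (inv_eq_self_of_sq proj_b_sq).symm ▸ hb
    · exact (inv_eq_self_of_sq proj_c_sq).symm ▸ hc
  | mul u v hu hv =>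
    intro h hh
    rw [map_mul, mul_assoc]
    exact hu _ (hv _ hh)

/-- Representatives of the elements of the dihedral group generated by `a` and `c`. -/
def dihedral : Set Gam :=
  {1, ga, gc, ga * gc, gc * ga, ga * gc * ga, gc * ga * gc, gc * ga * gc * ga}

theorem mul_mem_dihedral {d : Gam} (hd : d ∈ dihedral) :
    d * ga ∈ dihedral ∧ d * gc ∈ dihedral := by
  have hr : ga * (gc * (ga * gc)) = gc * (ga * (gc * ga)) := by
    have h := ((kills_iff _).1 proj_kills).2.1
    have h2 : (ga * gc * ga * gc) * (ga * gc * ga * gc) = 1 := by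
      simpa [pow_succ, mul_assoc] using h
    have h3 := inv_eq_self_of_sq h2
    simpa [inv_eq_self_of_sq proj_a_sq, inv_eq_self_of_sq proj_c_sq, mul_assoc] using h3.symm
  rcases hd with rfl | rfl | rfl | rfl | rfl | rfl | rfl | rfl <;>
  simp [dihedral, mul_assoc, proj_a_sq, proj_c_sq, mul_cancel_of_sq proj_c_sq, hr]

theorem commute_conj_left {t : Gam} (h : commElt gc t ^ 2 = 1) :
    Commute (ga * t⁻¹ * gc * (ga * t⁻¹)⁻¹) (ga * gc * ga) := by
  have := (Commute.conj_iff ga).2 (commute_of_commElt_sq proj_c_sq h).symm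
  simpa [mul_assoc, inv_eq_self_of_sq proj_a_sq] using this

theorem commute_conj_right {t : Gam} (h : commElt gc t ^ 2 = 1) :
    Commute (ga * t * gc * (ga * t)⁻¹) (ga * gc * ga) := by
  have := (Commute.conj_iff (ga * t)).2 (commute_of_commElt_sq proj_c_sq h)
  simpa [mul_assoc, inv_eq_self_of_sq proj_a_sq] using this

theorem commute_phi_conj_b {d : Gam} (hd : d ∈ dihedral) :
    Commute (phi (d * gb * d⁻¹)) (ga * gc * ga) := by
  obtain ⟨-, h1, h2, h3, h4, h5, h6⟩ := (kills_iff _).1 proj_kills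
  have h0 : commElt gc ga ^ 2 = 1 := by
    have := inv_eq_one.2 h1
    simpa [commElt, pow_succ, mul_assoc, inv_eq_self_of_sq proj_a_sq,
      inv_eq_self_of_sq proj_c_sq] using this
  have key : Commute (phi d * gc * (phi d)⁻¹) (ga * gc * ga) := by
    rcases hd with rfl | rfl | rfl | rfl | rfl | rfl | rfl | rfl
    · simpa [proj_a_sq, mul_assoc] using commute_conj_right h0
    · simpa [phi_a, mul_assoc, mul_cancel_of_sq proj_a_sq, inv_eq_self_of_sq proj_a_sq,
        inv_eq_self_of_sq proj_b_sq, proj_a_sq] using commute_conj_right h2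
    · simpa [phi_c, mul_assoc, inv_eq_self_of_sq proj_a_sq,
        inv_eq_self_of_sq proj_b_sq] using commute_conj_left h2
    · simpa [phi_a, phi_c, mul_assoc, mul_cancel_of_sq proj_a_sq, inv_eq_self_of_sq proj_a_sq,
        inv_eq_self_of_sq proj_b_sq, proj_a_sq] using commute_conj_left h4
    · simpa [phi_a, phi_c, mul_assoc, inv_eq_self_of_sq proj_a_sq,
        inv_eq_self_of_sq proj_b_sq] using commute_conj_left h3
    · simpa [phi_a, phi_c, mul_assoc, mul_cancel_of_sq proj_a_sq, inv_eq_self_of_sq proj_a_sq,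
        inv_eq_self_of_sq proj_b_sq, proj_a_sq] using commute_conj_right h5
    · simpa [phi_a, phi_c, mul_assoc, inv_eq_self_of_sq proj_a_sq,
        inv_eq_self_of_sq proj_b_sq] using commute_conj_left h5
    · simpa [phi_a, phi_c, mul_assoc, inv_eq_self_of_sq proj_a_sq,
        inv_eq_self_of_sq proj_b_sq] using commute_conj_left h6
  simpa [phi_b] using key

/-- Elements in the kernel of `psi` all of whose dihedral conjugates have image under `phi`
commuting with `aca`. -/
def Rigid (k : Gam) : Prop :=
  psi k = 1 ∧ ∀ d ∈ dihedral, Commute (phi (d * k * d⁻¹)) (ga * gc * ga)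

theorem Rigid.one : Rigid 1 := by simp [Rigid]

theorem Rigid.b_mul {k : Gam} (hk : Rigid k) : Rigid (gb * k) := by
  refine ⟨by rw [map_mul, psi_b, hk.1, one_mul], fun d hd => ?_⟩
  have := (commute_phi_conj_b hd).mul_left (hk.2 d hd)
  rw [← map_mul] at this
  simpa [mul_assoc] using this

theorem Rigid.conj {k x : Gam} (hk : Rigid k) (hx : ∀ d ∈ dihedral, d * x ∈ dihedral) :
    Rigid (x * k * x⁻¹) := by
  refine ⟨by simp [hk.1], fun d hd => ?_⟩
  have := hk.2 (d * x) (hx d hd)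
  simpa [mul_assoc] using this

theorem Rigid.commute {k : Gam} (hk : Rigid k) : Commute (phi k) (ga * gc * ga) := by
  simpa using hk.2 1 (by simp [dihedral])

/-- The elements `aφ(k)a·φ(h)` with `k` rigid; they form the first-level stabilizer. -/
def Split (g : Gam) : Prop := ∃ k h, Rigid k ∧ g = ga * phi k * ga * phi h

theorem Split.b_mul {g : Gam} (hg : Split g) : Split (gb * g) := by
  obtain ⟨k, h, hk, rfl⟩ := hg
  refine ⟨gc * k * gc⁻¹, ga * h, hk.conj fun d hd => (mul_mem_dihedral hd).2, ?_⟩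
  simp [phi_a, phi_c, mul_assoc, inv_eq_self_of_sq proj_a_sq, inv_eq_self_of_sq proj_b_sq,
    mul_cancel_of_sq proj_a_sq, mul_cancel_of_sq proj_b_sq]

theorem Split.aba_mul {g : Gam} (hg : Split g) : Split (ga * gb * ga * g) := by
  obtain ⟨k, h, hk, rfl⟩ := hg
  refine ⟨ga * k * ga⁻¹, gc * h, hk.conj fun d hd => (mul_mem_dihedral hd).1, ?_⟩
  simp [phi_a, phi_c, mul_assoc, inv_eq_self_of_sq proj_b_sq,
    mul_cancel_of_sq proj_a_sq, mul_cancel_of_sq proj_b_sq]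

theorem Split.aca_mul {g : Gam} (hg : Split g) : Split (ga * gc * ga * g) := by
  obtain ⟨k, h, hk, rfl⟩ := hg
  refine ⟨gb * k, h, hk.b_mul, ?_⟩
  simp [phi_b, mul_assoc, mul_cancel_of_sq proj_a_sq]

theorem Split.c_mul {g : Gam} (hg : Split g) : Split (gc * g) := by
  obtain ⟨k, h, hk, rfl⟩ := hg
  refine ⟨k, gb * h, hk, ?_⟩
  have := (Commute.conj_iff ga).2 hk.commute
  simp only [inv_eq_self_of_sq proj_a_sq, mul_assoc, proj_a_sq, mul_cancel_of_sq proj_a_sq,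
    mul_one] at this
  have e := this.eq
  simp only [mul_assoc] at e
  simp only [map_mul, phi_b, mul_assoc]
  rw [← mul_assoc ga gc, ← mul_assoc (phi k)]
  simpa [mul_assoc] using congrArg (· * phi h) e.symm

theorem split_or (g : Gam) : Split g ∨ Split (ga * g) := by
  induction g using induction_left with
  | one => exact Or.inl ⟨1, 1, Rigid.one, by simp [proj_a_sq]⟩
  | ha g ih =>
    rw [← mul_assoc, proj_a_sq, one_mul]
    exact ih.symm
  | hb g ih =>
    refine ih.imp Split.b_mul fun h => ?_
    simpa [mul_assoc, mul_cancel_of_sq proj_a_sq] using h.aba_mul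
  | hc g ih =>
    refine ih.imp Split.c_mul fun h => ?_
    simpa [mul_assoc, mul_cancel_of_sq proj_a_sq] using h.aca_mul

theorem act_a (x : Bool) (h : Gam) : act ga (x, h) = (!x, h) := by
  rw [act_proj, wreath_a]

theorem act_split_false {k : Gam} (hk : Rigid k) (g h : Gam) :
    act (ga * phi k * ga * phi g) (false, h) = (false, g * h) := by
  simp [act_a, act_phi_false, act_phi_true, hk.1]

theorem act_injective : Function.Injective act := by
  rw [injective_iff_map_eq_one]
  intro g hg
  rcases split_or g with ⟨k, h, hk, rfl⟩ | ⟨k, h, hk, e⟩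
  · have h1 : h = 1 := by simpa [hg] using (act_split_false hk h 1).symm
    subst h1
    have h2 : act (ga * phi k * ga * phi 1) (true, 1) = (true, k) := by
      simp [act_a, act_phi_false]
    rw [hg] at h2
    have h3 : k = 1 := by simpa using h2.symm
    simp [h3, proj_a_sq]
  · have h1 := act_split_false hk h 1
    rw [← e, map_mul, hg, mul_one, act_a] at h1
    simp at h1

/-- The action of the free group on the binary tree. -/
def tree : F →* Perm (List Bool) := FreeGroup.lift ![treeA, treeB, treeC]

theorem tree_a : tree fa = treeA := by simp [tree]
theorem tree_b : tree fb = treeB := by simp [tree]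
theorem tree_c : tree fc = treeC := by simp [tree]

theorem treeA_apply (l : List Bool) : treeA l = aFun l := rfl
theorem treeB_apply (l : List Bool) : treeB l = bFun l := rfl
theorem treeC_apply (l : List Bool) : treeC l = cFun l := rfl

theorem tree_cons (w : F) (q : Bool × List Bool) :
    tree w (q.1 :: q.2) = (wreath tree w q).1 :: (wreath tree w q).2 := by
  induction w using FreeGroup.induction_on generalizing q with
  | C1 => simp
  | of i =>
    obtain ⟨x, l⟩ := q
    fin_cases i <;> cases x <;>
    simp [tree_a, tree_b, tree_c, treeA_apply, treeB_apply, treeC_apply, aFun, bFun, cFun]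
  | inv_of i ih =>
    rw [map_inv, map_inv, Perm.inv_eq_iff_eq, ih]
    simp
  | mul u v hu hv => simp [hu, hv]

theorem tree_nil (w : F) : tree w [] = [] := by
  induction w using FreeGroup.induction_on with
  | C1 => simp
  | of i =>
    fin_cases i <;> simp [tree_a, tree_b, tree_c, treeA_apply, treeB_apply, treeC_apply, aFun, bFun, cFun]
  | inv_of i ih => rw [map_inv, Perm.inv_eq_iff_eq, ih]
  | mul u v hu hv => simp [hu, hv]

theorem tree_eq_one_iff (w : F) : tree w = 1 ↔ wreath tree w = 1 := by
  constructor
  · intro h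
    ext1 q
    have := tree_cons w q
    rw [h, Perm.one_apply, List.cons.injEq] at this
    exact Prod.ext this.1.symm this.2.symm
  · intro h
    ext1 l
    cases l with
    | nil => exact tree_nil w
    | cons x l => simpa [h] using tree_cons w (x, l)

theorem tree_a_sq : tree fa * tree fa = 1 := by
  rw [tree_a]; exact Equiv.ext aFun_involutive
theorem tree_b_sq : tree fb * tree fb = 1 := by
  rw [tree_b]; exact Equiv.ext fun l => (bcFun_involutive l).1
theorem tree_c_sq : tree fc * tree fc = 1 := by
  rw [tree_c]; exact Equiv.ext fun l => (bcFun_involutive l).2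

theorem tree_kills : Kills tree := fun r hr =>
  (tree_eq_one_iff r).2 (wreath_kills tree_a_sq tree_b_sq tree_c_sq r hr)

theorem tree_iterRels (w : F) (hw : w ∈ iterRels) : tree w = 1 := by
  obtain ⟨n, r, hr, rfl⟩ := hw
  induction n with
  | zero => exact tree_kills r hr
  | succ n ih =>
    rw [Function.iterate_succ_apply', tree_eq_one_iff]
    exact wreath_subst_eq_one ih (map_cosubst_iterRels tree_a_sq tree_c_sq
      ((kills_iff _).1 tree_kills).2.1 ⟨n, r, hr, rfl⟩)

/-- If the word `l` acts trivially on the tree, then it is trivial in the presented group. -/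
def Detected (l : List (Fin 3)) : Prop := tree (word l) = 1 → proj (word l) = 1

theorem Detected.of_sections {l : List (Fin 3)} (h : ∀ x, Detected (wordSection x l)) :
    Detected l := by
  intro hl
  rw [tree_eq_one_iff] at hl
  have him (x : Bool) (v : List Bool) : x = image x l ∧ v = tree (word (wordSection x l)) v := by
    have := wreath_word tree l x v
    rwa [hl, Perm.one_apply, Prod.mk.injEq] at this
  refine act_injective (Equiv.ext fun ⟨x, v⟩ => ?_)
  have hx : proj (word (wordSection x l)) = 1 :=
    h x (Equiv.ext fun v => ((him x v).2).symm)
  rw [act_proj, wreath_word, ← (him x []).1, regular_eq_one hx, map_one]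
  rfl

theorem tree_of_ne_one (g : Fin 3) : tree (FreeGroup.of g) ≠ 1 := by
  intro h
  have := DFunLike.congr_fun h [false, false, false]
  revert this
  fin_cases g <;> simp [tree_a, tree_b, tree_c, treeA_apply, treeB_apply, treeC_apply, aFun, bFun, cFun]

theorem proj_of_sq (g : Fin 3) : proj (FreeGroup.of g) * proj (FreeGroup.of g) = 1 := by
  fin_cases g
  · exact proj_a_sq
  · exact proj_b_sq
  · exact proj_c_sq

theorem tree_of_sq (g : Fin 3) : tree (FreeGroup.of g) * tree (FreeGroup.of g) = 1 := by
  fin_cases g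
  · exact tree_a_sq
  · exact tree_b_sq
  · exact tree_c_sq

theorem Detected.of_constant {l : List (Fin 3)} {g : Fin 3} (hl : ∀ x ∈ l, x = g) :
    Detected l := by
  rw [List.eq_replicate_of_mem hl]
  intro h
  simp only [word, List.map_replicate, List.prod_replicate, map_pow] at h ⊢
  rcases Nat.even_or_odd' l.length with ⟨m, hm | hm⟩
  · rw [hm, pow_mul, pow_two, proj_of_sq, one_pow]
  · rw [hm, pow_succ, pow_mul, pow_two, tree_of_sq, one_pow, one_mul] at h
    exact absurd h (tree_of_ne_one g)

theorem detected (l : List (Fin 3)) : Detected l := by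
  induction hn : l.length using Nat.strong_induction_on generalizing l with
  | _ n ih =>
    have step (m : List (Fin 3)) (hm : m.length ≤ n) (h0 : 0 ∈ m) : Detected m := by
      refine Detected.of_sections fun x => ih _ ?_ _ rfl
      have := length_wordSection x m
      have := List.count_pos_iff.2 h0
      omega
    by_cases h0 : 0 ∈ l
    · exact step l hn.le h0
    · obtain ⟨h1, h2⟩ := wordSection_of_zero_notMem h0
      refine Detected.of_sections fun x => ?_
      cases x with
      | true => exact Detected.of_constant h1
      | false =>
        by_cases h3 : 0 ∈ wordSection false l
        · exact step _ (by have := length_wordSection false l; omega) h3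
        · exact Detected.of_constant fun g hg => (h2 g hg).resolve_left fun e => h3 (e ▸ hg)

/-- The action of the presented group on the binary tree. -/
def treeGam : Gam →* Perm (List Bool) := descend tree tree_iterRels

theorem treeGam_proj (w : F) : treeGam (proj w) = tree w := descend_proj _ _ w

theorem exists_word (g : Gam) : ∃ l, proj (word l) = g := by
  induction g using induction_left with
  | one => exact ⟨[], map_one _⟩
  | ha g ih => obtain ⟨l, rfl⟩ := ih; exact ⟨0 :: l, by simp⟩
  | hb g ih => obtain ⟨l, rfl⟩ := ih; exact ⟨1 :: l, by simp⟩
  | hc g ih => obtain ⟨l, rfl⟩ := ih; exact ⟨2 :: l, by simp⟩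

theorem treeGam_injective : Function.Injective treeGam := by
  rw [injective_iff_map_eq_one]
  intro g hg
  obtain ⟨l, rfl⟩ := exists_word g
  exact detected l (by rwa [treeGam_proj] at hg)

theorem range_treeGam : treeGam.range = IMG := by
  apply le_antisymm
  · rintro _ ⟨g, rfl⟩
    induction g using induction_left with
    | one => rw [map_one]; exact one_mem _
    | ha g ih => rw [map_mul, treeGam_proj, tree_a]; exact mul_mem treeA_mem_IMG ih
    | hb g ih => rw [map_mul, treeGam_proj, tree_b]; exact mul_mem treeB_mem_IMG ih
    | hc g ih => rw [map_mul, treeGam_proj, tree_c]; exact mul_mem treeC_mem_IMG ih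
  · rw [IMG, Subgroup.closure_le]
    rintro _ (rfl | rfl | rfl)
    · exact ⟨ga, by rw [treeGam_proj, tree_a]⟩
    · exact ⟨gb, by rw [treeGam_proj, tree_b]⟩
    · exact ⟨gc, by rw [treeGam_proj, tree_c]⟩

/-- The endomorphic presentation of `IMG`. -/
noncomputable def gamEquiv : Gam ≃* IMG :=
  (MonoidHom.ofInjective treeGam_injective).trans (MulEquiv.subgroupCongr range_treeGam)

theorem coe_gamEquiv (g : Gam) : (gamEquiv g : Perm (List Bool)) = treeGam g := rfl

/-- The free group on `a, b, c` mapped to `𝔾̃`. -/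
def toGtildeFree : F →* Gtilde :=
  (PresentedGroup.mk GtildeRels).comp (FreeGroup.map Fin.castSucc)

theorem toGtildeFree_a : toGtildeFree fa = PresentedGroup.of 0 := rfl
theorem toGtildeFree_b : toGtildeFree fb = PresentedGroup.of 1 := rfl
theorem toGtildeFree_c : toGtildeFree fc = PresentedGroup.of 2 := rfl

theorem mk_rel {r : FreeGroup (Fin 4)} (hr : r ∈ GtildeRels) :
    PresentedGroup.mk GtildeRels r = 1 := PresentedGroup.one_of_mem hr

theorem toGtildeFree_kills : Kills toGtildeFree := by
  intro r hr
  refine mk_rel ?_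
  rcases hr with rfl | rfl | rfl | rfl | rfl | rfl | rfl <;> simp [GtildeRels, commElt]

theorem toGtildeFree_subst (w : F) : toGtildeFree (subst w) =
    (PresentedGroup.of 3)⁻¹ * toGtildeFree w * PresentedGroup.of 3 := by
  have h0 := mk_rel (r := (FreeGroup.of 3)⁻¹ * FreeGroup.of 0 * FreeGroup.of 3 *
    (FreeGroup.of 1)⁻¹) (by simp [GtildeRels])
  have h1 := mk_rel (r := (FreeGroup.of 3)⁻¹ * FreeGroup.of 1 * FreeGroup.of 3 *
    (FreeGroup.of 2)⁻¹) (by simp [GtildeRels])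
  have h2 := mk_rel (r := (FreeGroup.of 3)⁻¹ * FreeGroup.of 2 * FreeGroup.of 3 *
    (FreeGroup.of 0 * FreeGroup.of 1 * FreeGroup.of 0)⁻¹) (by simp [GtildeRels])
  have h : toGtildeFree.comp subst =
      (MulAut.conj (PresentedGroup.of (rels := GtildeRels) 3)⁻¹).toMonoidHom.comp
        toGtildeFree := by
    ext i
    fin_cases i
    · simpa [toGtildeFree_a, toGtildeFree_b] using (mul_inv_eq_one.1 h0).symm
    · simpa [toGtildeFree_b, toGtildeFree_c] using (mul_inv_eq_one.1 h1).symm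
    · simpa [toGtildeFree_a, toGtildeFree_b, toGtildeFree_c] using (mul_inv_eq_one.1 h2).symm
  simpa using DFunLike.congr_fun h w

/-- The homomorphism from the endomorphic presentation to `𝔾̃`. -/
def toGtilde : Gam →* Gtilde :=
  descend toGtildeFree (by
    rintro _ ⟨n, r, hr, rfl⟩
    induction n with
    | zero => exact toGtildeFree_kills r hr
    | succ n ih => rw [Function.iterate_succ_apply', toGtildeFree_subst, ih]; simp)

theorem toGtilde_proj (w : F) : toGtilde (proj w) = toGtildeFree w := descend_proj _ _ w

/-- The ascending HNN extension of the presented group along `phi`. -/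
abbrev Ascending : Type :=
  HNNExtension Gam ⊤ phi.range
    (Subgroup.topEquiv.trans (MonoidHom.ofInjective phi_injective))

theorem t_mul_of_mul_inv (g : Gam) :
    (HNNExtension.t * HNNExtension.of g * HNNExtension.t⁻¹ : Ascending) =
      HNNExtension.of (phi g) :=
  (HNNExtension.equiv_eq_conj (⟨g, trivial⟩ : (⊤ : Subgroup Gam))).symm

/-- Images of the generators of `𝔾̃` in the ascending HNN extension. -/
noncomputable def ascendingGen : Fin 4 → Ascending :=
  ![HNNExtension.of ga, HNNExtension.of gb, HNNExtension.of gc, HNNExtension.t⁻¹]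

theorem ascendingGen_rels (r : FreeGroup (Fin 4)) (hr : r ∈ GtildeRels) :
    FreeGroup.lift ascendingGen r = 1 := by
  have hk : Kills ((HNNExtension.of : Gam →* Ascending).comp proj) := fun r hr => by
    rw [MonoidHom.comp_apply, proj_kills r hr, map_one]
  obtain ⟨h0, h1, h2, h3, h4, h5, h6⟩ := (kills_iff _).1 hk
  rcases hr with rfl | rfl | rfl | rfl | rfl | rfl | rfl | rfl | rfl | rfl
  · simpa [ascendingGen] using h0
  · simpa [ascendingGen] using h1
  · simpa [ascendingGen, commElt] using h2
  · simpa [ascendingGen, commElt] using h3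
  · simpa [ascendingGen, commElt] using h4
  · simpa [ascendingGen, commElt] using h5
  · simpa [ascendingGen, commElt] using h6
  · simp [ascendingGen, t_mul_of_mul_inv, phi_a]
  · simp [ascendingGen, t_mul_of_mul_inv, phi_b]
  · rw [map_mul, map_inv, mul_inv_eq_one]
    simp [ascendingGen, t_mul_of_mul_inv, phi_c]

theorem toGtilde_injective : Function.Injective toGtilde := by
  have h : ((PresentedGroup.toGroup ascendingGen_rels).comp toGtilde).comp proj =
      (HNNExtension.of : Gam →* Ascending).comp proj := by
    ext i
    simp only [MonoidHom.comp_apply, toGtilde_proj]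
    fin_cases i
    · exact (congrArg _ toGtildeFree_a).trans (PresentedGroup.toGroup.of ascendingGen_rels)
    · exact (congrArg _ toGtildeFree_b).trans (PresentedGroup.toGroup.of ascendingGen_rels)
    · exact (congrArg _ toGtildeFree_c).trans (PresentedGroup.toGroup.of ascendingGen_rels)
  have h' := MonoidHom.cancel_right proj_surjective |>.1 h
  have hinj := HNNExtension.of_injective (G := Gam) (A := ⊤) (B := phi.range)
    (φ := Subgroup.topEquiv.trans (MonoidHom.ofInjective phi_injective))
  rw [← h', MonoidHom.coe_comp] at hinj
  exact hinj.of_comp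

end IMGEmbedding

/-- `G` embeds into the finitely presented group `𝔾̃`, via `a, b, c` to the
images of the generators `a, b, c` of `𝔾̃`. -/
theorem IMG_embeds_into_Gtilde :
    ∃ ι : IMG →* Gtilde, Function.Injective ι ∧
      ι gA = PresentedGroup.of 0 ∧ ι gB = PresentedGroup.of 1 ∧
      ι gC = PresentedGroup.of 2 := by
  have symm_eq {x : IMG} {w : IMGEmbedding.F} (h : IMGEmbedding.tree w = x) :
      IMGEmbedding.gamEquiv.symm x = IMGEmbedding.proj w := by
    rw [MulEquiv.symm_apply_eq]
    exact Subtype.ext (by rw [IMGEmbedding.coe_gamEquiv, IMGEmbedding.treeGam_proj, h])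
  refine ⟨IMGEmbedding.toGtilde.comp IMGEmbedding.gamEquiv.symm.toMonoidHom,
    IMGEmbedding.toGtilde_injective.comp IMGEmbedding.gamEquiv.symm.injective, ?_, ?_, ?_⟩
  · exact (congrArg _ (symm_eq IMGEmbedding.tree_a)).trans
      ((IMGEmbedding.toGtilde_proj _).trans IMGEmbedding.toGtildeFree_a)
  · exact (congrArg _ (symm_eq IMGEmbedding.tree_b)).trans
      ((IMGEmbedding.toGtilde_proj _).trans IMGEmbedding.toGtildeFree_b)
  · exact (congrArg _ (symm_eq IMGEmbedding.tree_c)).trans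
      ((IMGEmbedding.toGtilde_proj _).trans IMGEmbedding.toGtildeFree_c)
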